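/- For every n ≥ 1, the group (F₂)^n admits a faithful complex linear representation of dimension 2n but none of dimension 2n − 1; that is, there is an injective group homomorphism from (F₂)^n into GL_{2n}(ℂ), while there is no injective group homomorphism from (F₂)^n into GL_{2n−1}(ℂ). Equivalently, the minimal dimension of a faithful complex representation of (F₂)^n is 2n. -/

import Mathlib

/-- The image of the representation is solvable. -/
def SolvRep {G V : Type} [Group G] [AddCommGroup V] [Module ℂ V] (ρ : Representation ℂ G V) : Prop :=
  ∃ m, ∀ k ∈ derivedSeries G m, ∀ x, ρ k x = x

lemma solvRep_of_comm {G V : Type} [Group G] [AddCommGroup V] [Module ℂ V]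
    (ρ : Representation ℂ G V) (m : ℕ)
    (h : ∀ a ∈ derivedSeries G m, ∀ b ∈ derivedSeries G m, ∀ x, ρ a (ρ b x) = ρ b (ρ a x)) :
    SolvRep ρ := by
  have key : derivedSeries G (m+1) ≤ MonoidHom.ker (ρ : G →* (V →ₗ[ℂ] V)) := by
    rw [derivedSeries_succ, Subgroup.commutator_le]
    intro a ha b hb
    rw [MonoidHom.mem_ker]
    have h1 : ρ (a * b) = ρ (b * a) := by
      ext x
      simpa using h a ha b hb x
    have h2 : a * b * a⁻¹ * b⁻¹ = (a * b) * (b * a)⁻¹ := by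
      group
    rw [commutatorElement_def, h2, map_mul, h1, ← map_mul, mul_inv_cancel, map_one]
  refine ⟨m+1, fun k hk x => ?_⟩
  have := key hk
  rw [MonoidHom.mem_ker] at this
  rw [this]; rfl

lemma solvRep_ext {G V : Type} [Group G] [AddCommGroup V] [Module ℂ V]
    (ρ : Representation ℂ G V) (W : Submodule ℂ V) (hW : ∀ g, W ≤ W.comap (ρ g))
    (h1 : SolvRep (ρ.subrepresentation W hW)) (h2 : SolvRep (ρ.quotient W hW)) : SolvRep ρ := by
  obtain ⟨m1, h1⟩ := h1
  obtain ⟨m2, h2⟩ := h2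
  have e1 : ∀ k ∈ derivedSeries G (max m1 m2), ∀ x ∈ W, ρ k x = x := by
    intro k hk x hx
    have := h1 k (derivedSeries_antitone G (le_max_left _ _) hk) ⟨x, hx⟩
    exact congrArg Subtype.val this
  have e2 : ∀ k ∈ derivedSeries G (max m1 m2), ∀ x, ρ k x - x ∈ W := by
    intro k hk x
    have := h2 k (derivedSeries_antitone G (le_max_right _ _) hk) (Submodule.Quotient.mk x)
    exact (Submodule.Quotient.eq W).1 this
  refine solvRep_of_comm ρ (max m1 m2) ?_
  intro a ha b hb x
  have p := e1 a ha _ (e2 b hb x)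
  have q := e1 b hb _ (e2 a ha x)
  rw [map_sub, sub_eq_iff_eq_add] at p q
  rw [p, q]; abel

lemma key_bound {G : Type} [Group G] : ∀ (d : ℕ) (V : Type) [AddCommGroup V] [Module ℂ V]
    [FiniteDimensional ℂ V] (ι : Type) [Fintype ι] (ρ : ι → Representation ℂ G V),
    Module.finrank ℂ V = d →
    (∀ i j, i ≠ j → ∀ g h x, ρ i g (ρ j h x) = ρ j h (ρ i g x)) →
    (∀ i, ¬ SolvRep (ρ i)) → 2 * Fintype.card ι ≤ d := by
  classical
  intro d
  induction d using Nat.strong_induction_on with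
  | _ d IH =>
  intro V _ _ _ ι _ ρ hd hc hns
  by_cases hι : IsEmpty ι
  · simp
  rw [not_isEmpty_iff] at hι
  obtain ⟨i0⟩ := hι
  have hfr : ∀ W : Submodule ℂ V, Module.finrank ℂ (V ⧸ W) + Module.finrank ℂ W = d := by
    intro W; rw [← hd]; exact W.finrank_quotient_add_finrank
  have hpos : ∀ W : Submodule ℂ V, W ≠ ⊥ → 0 < Module.finrank ℂ W := by
    intro W hW
    exact Nat.pos_of_ne_zero fun h => hW (Submodule.finrank_eq_zero.1 h)
  have hlt : ∀ W : Submodule ℂ V, W ≠ ⊤ → Module.finrank ℂ W < d := by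
    intro W hW
    rw [← hd]; exact Submodule.finrank_lt hW
  by_cases hred : ∃ W : Submodule ℂ V, W ≠ ⊥ ∧ W ≠ ⊤ ∧ ∀ i g, W ≤ W.comap (ρ i g)
  · obtain ⟨W, hb, ht, hW⟩ := hred
    have := hfr W
    have := hpos W hb
    have := hlt W ht
    have A := IH (Module.finrank ℂ W) (by omega) W
      {i // ¬ SolvRep ((ρ i).subrepresentation W (hW i))}
      (fun i => (ρ i.1).subrepresentation W (hW i.1)) rfl
      (by
        intro i j hij g h x
        apply Subtype.ext
        exact hc i.1 j.1 (fun e => hij (Subtype.ext e)) g h x.1)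
      (fun i => i.2)
    have B := IH (Module.finrank ℂ (V ⧸ W)) (by omega) (V ⧸ W)
      {i // ¬ SolvRep ((ρ i).quotient W (hW i))}
      (fun i => (ρ i.1).quotient W (hW i.1)) rfl
      (by
        intro i j hij g h x
        obtain ⟨x, rfl⟩ := Submodule.Quotient.mk_surjective W x
        exact congrArg (Submodule.Quotient.mk (p := W))
          (hc i.1 j.1 (fun e => hij (Subtype.ext e)) g h x))
      (fun i => i.2)
    have C : Fintype.card ι ≤ Fintype.card {i // ¬ SolvRep ((ρ i).subrepresentation W (hW i))}
        + Fintype.card {i // ¬ SolvRep ((ρ i).quotient W (hW i))} := by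
      refine le_trans (le_of_eq ?_) (Fintype.card_subtype_or _ _)
      rw [← Fintype.card_congr (Equiv.subtypeUnivEquiv (p := fun i =>
        ¬ SolvRep ((ρ i).subrepresentation W (hW i)) ∨ ¬ SolvRep ((ρ i).quotient W (hW i))) ?_)]
      intro i
      by_contra hcon
      push Not at hcon
      exact hns i (solvRep_ext _ W (hW i) hcon.1 hcon.2)
    omega
  · -- irreducible case
    have hirr : ∀ W : Submodule ℂ V, (∀ i g, ∀ x ∈ W, ρ i g x ∈ W) → W = ⊥ ∨ W = ⊤ := by
      intro W hW
      by_contra hcon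
      push Not at hcon
      exact hred ⟨W, hcon.1, hcon.2, fun i g x hx => hW i g x hx⟩
    have hnt : Nontrivial V := by
      by_contra hcon
      rw [not_nontrivial_iff_subsingleton] at hcon
      exact hns i0 ⟨0, fun k _ x => Subsingleton.elim _ _⟩
    obtain ⟨h, hh⟩ : ∃ h, ∀ c : ℂ, ¬ ∀ x, ρ i0 h x = c • x := by
      by_contra hcon
      push Not at hcon
      refine hns i0 (solvRep_of_comm _ 0 ?_)
      intro a _ b _ x
      obtain ⟨c, hc⟩ := hcon a
      rw [hc, hc, map_smul]
    obtain ⟨c, hev⟩ := Module.End.exists_eigenvalue (ρ i0 h)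
    set E := Module.End.eigenspace (ρ i0 h) c with hE
    have hEb : E ≠ ⊥ := hev
    have hEt : E ≠ ⊤ := by
      intro ht
      refine hh c fun x => ?_
      have : x ∈ E := by rw [ht]; trivial
      exact Module.End.mem_eigenspace_iff.1 this
    have hEinv : ∀ i : {i // i ≠ i0}, ∀ g, E ≤ E.comap (ρ i.1 g) := by
      intro i g x hx
      rw [Submodule.mem_comap, hE, Module.End.mem_eigenspace_iff]
      rw [hE, Module.End.mem_eigenspace_iff] at hx
      rw [← hc i.1 i0 i.2, hx, map_smul]
    have := hfr E
    have := hpos E hEb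
    have := hlt E hEt
    have A := IH (Module.finrank ℂ E) (by omega) E {i // i ≠ i0}
      (fun i => (ρ i.1).subrepresentation E (hEinv i)) rfl
      (by
        intro i j hij g h x
        apply Subtype.ext
        exact hc i.1 j.1 (fun e => hij (Subtype.ext e)) g h x.1)
      (by
        rintro i ⟨m, hm⟩
        have hm : ∀ k ∈ derivedSeries G m, ∀ x ∈ E, ρ i.1 k x = x := fun k hk x hx =>
          congrArg Subtype.val (hm k hk ⟨x, hx⟩)
        let W : Submodule ℂ V :=
          { carrier := {x | ∀ k ∈ derivedSeries G m, ρ i.1 k x = x}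
            add_mem' := by
              intro a b ha hb k hk
              rw [map_add, ha k hk, hb k hk]
            zero_mem' := by intro k hk; simp
            smul_mem' := by
              intro c a ha k hk
              rw [map_smul, ha k hk] }
        have hEW : E ≤ W := fun x hx k hk => hm k hk x hx
        have := hirr W (by
          intro j g x hx k hk
          by_cases hij : i.1 = j
          · subst hij
            have h1 := hx (g⁻¹ * k * g) (by
              simpa using (derivedSeries_normal G m).conj_mem k hk g⁻¹)
            conv_rhs => rw [← h1]
            rw [← Module.End.mul_apply, ← Module.End.mul_apply, ← map_mul, ← map_mul]
            congr 2; group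
          · rw [hc _ _ hij, hx k hk])
        rcases this with h0 | h0
        · exact hEb (le_bot_iff.1 (h0 ▸ hEW))
        · refine hns i.1 ⟨m, fun k hk x => ?_⟩
          have : x ∈ W := by rw [h0]; trivial
          exact this k hk)
    have B := IH (Module.finrank ℂ (V ⧸ E)) (by omega) (V ⧸ E) {i // i ≠ i0}
      (fun i => (ρ i.1).quotient E (hEinv i)) rfl
      (by
        intro i j hij g h x
        obtain ⟨x, rfl⟩ := Submodule.Quotient.mk_surjective E x
        exact congrArg (Submodule.Quotient.mk (p := E))
          (hc i.1 j.1 (fun e => hij (Subtype.ext e)) g h x))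
      (by
        rintro i ⟨m, hm⟩
        have hm : ∀ k ∈ derivedSeries G m, ∀ x, ρ i.1 k x - x ∈ E := fun k hk x =>
          (Submodule.Quotient.eq E).1 (hm k hk (Submodule.Quotient.mk x))
        let S : Set V := {y | ∃ k ∈ derivedSeries G m, ∃ x, y = ρ i.1 k x - x}
        have hSE : Submodule.span ℂ S ≤ E := by
          rw [Submodule.span_le]
          rintro y ⟨k, hk, x, rfl⟩
          exact hm k hk x
        have := hirr (Submodule.span ℂ S) (by
          intro j g y hy
          suffices Submodule.span ℂ S ≤ (Submodule.span ℂ S).comap (ρ j g) from this hy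
          rw [Submodule.span_le]
          rintro y ⟨k, hk, x, rfl⟩
          refine Submodule.subset_span ?_
          by_cases hij : i.1 = j
          · subst hij
            refine ⟨g * k * g⁻¹, (derivedSeries_normal G m).conj_mem k hk g, ρ i.1 g x, ?_⟩
            rw [map_sub]
            congr 1
            rw [← Module.End.mul_apply, ← Module.End.mul_apply, ← map_mul, ← map_mul]
            congr 2; group
          · refine ⟨k, hk, ρ j g x, ?_⟩
            rw [map_sub, hc _ _ hij])
        rcases this with h0 | h0
        · refine hns i.1 ⟨m, fun k hk x => ?_⟩
          have : ρ i.1 k x - x ∈ Submodule.span ℂ S := Submodule.subset_span ⟨k, hk, x, rfl⟩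
          rw [h0, Submodule.mem_bot] at this
          exact sub_eq_zero.1 this
        · exact hEt (top_le_iff.1 (h0 ▸ hSE)))
    have hcard : Fintype.card {i // i ≠ i0} = Fintype.card ι - 1 := by
      simpa using Fintype.card_subtype_compl (fun i => i = i0)
    have : 0 < Fintype.card ι := Fintype.card_pos_iff.2 ⟨i0⟩
    omega

lemma free_not_solv : ¬ Group.IsSolvable (FreeGroup (Fin 2)) := by
  intro hs
  let F : FreeGroup (Fin 2) →* Equiv.Perm (Fin 5) :=
    FreeGroup.lift ![finRotate 5, Equiv.swap 0 (finRotate 5 0)]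
  have hF : Function.Surjective F := by
    rw [← MonoidHom.range_eq_top, eq_top_iff,
      ← Equiv.Perm.closure_cycle_adjacent_swap (isCycle_finRotate (n := 3)) support_finRotate 0,
      Subgroup.closure_le]
    rintro x (rfl | rfl)
    · exact ⟨FreeGroup.of 0, by simp [F]⟩
    · exact ⟨FreeGroup.of 1, by simp [F]⟩
  exact Equiv.Perm.not_isSolvable_fin_5 (Group.isSolvable_of_surjective hF)

open Matrix in
lemma free_embed : ∃ f : FreeGroup (Fin 2) →* Matrix (Fin 2) (Fin 2) ℂ, Function.Injective f := by
  let A : SpecialLinearGroup (Fin 2) ℤ := ⟨!![1, 3; 0, 1], by simp [det_fin_two]⟩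
  let B : SpecialLinearGroup (Fin 2) ℤ := ⟨!![1, 0; 3, 1], by simp [det_fin_two]⟩
  let X : Fin 2 → Set (SpecialLinearGroup (Fin 2) ℤ) :=
    ![{g | 3 * (g 1 0 * g 1 0) ≤ 2 * (g 0 0 * g 1 0)},
      {g | 3 * (g 0 0 * g 0 0) ≤ 2 * (g 0 0 * g 1 0)}]
  let Y : Fin 2 → Set (SpecialLinearGroup (Fin 2) ℤ) :=
    ![{g | 2 * (g 0 0 * g 1 0) < - 3 * (g 1 0 * g 1 0)},
      {g | 2 * (g 0 0 * g 1 0) < - 3 * (g 0 0 * g 0 0)}]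
  have hne : ∀ g : SpecialLinearGroup (Fin 2) ℤ, 0 < g 0 0 * g 0 0 + g 1 0 * g 1 0 := by
    intro g
    have := g.det_coe
    rw [det_fin_two] at this
    by_contra hcon
    have h0 : g 0 0 = 0 := by nlinarith [mul_self_nonneg (g 0 0), mul_self_nonneg (g 1 0)]
    have h1 : g 1 0 = 0 := by nlinarith [mul_self_nonneg (g 0 0), mul_self_nonneg (g 1 0)]
    rw [h0, h1] at this
    simp at this
  have hA0 : ∀ g : SpecialLinearGroup (Fin 2) ℤ, (A * g) 0 0 = g 0 0 + 3 * g 1 0 := by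
    intro g; change ((!![1, 3; 0, 1] : Matrix (Fin 2) (Fin 2) ℤ) * g.1) 0 0 = _
    rw [Matrix.mul_apply, Fin.sum_univ_two]; simp
  have hA1 : ∀ g : SpecialLinearGroup (Fin 2) ℤ, (A * g) 1 0 = g 1 0 := by
    intro g; change ((!![1, 3; 0, 1] : Matrix (Fin 2) (Fin 2) ℤ) * g.1) 1 0 = _
    rw [Matrix.mul_apply, Fin.sum_univ_two]; simp
  have hB0 : ∀ g : SpecialLinearGroup (Fin 2) ℤ, (B * g) 0 0 = g 0 0 := by
    intro g; change ((!![1, 0; 3, 1] : Matrix (Fin 2) (Fin 2) ℤ) * g.1) 0 0 = _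
    rw [Matrix.mul_apply, Fin.sum_univ_two]; simp
  have hB1 : ∀ g : SpecialLinearGroup (Fin 2) ℤ, (B * g) 1 0 = 3 * g 0 0 + g 1 0 := by
    intro g; change ((!![1, 0; 3, 1] : Matrix (Fin 2) (Fin 2) ℤ) * g.1) 1 0 = _
    rw [Matrix.mul_apply, Fin.sum_univ_two]; simp
  have hinj : Function.Injective (FreeGroup.lift ![A, B]) := by
    apply FreeGroup.injective_lift_of_ping_pong ![A, B] X Y
    · intro i
      fin_cases i
      · exact ⟨A, by change 3 * (A 1 0 * A 1 0) ≤ 2 * (A 0 0 * A 1 0); simp [A]⟩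
      · exact ⟨B, by change 3 * (B 0 0 * B 0 0) ≤ 2 * (B 0 0 * B 1 0); simp [B]⟩
    · intro i j hij
      rw [Function.onFun, Set.disjoint_left]
      intro g
      have := hne g
      have := mul_self_nonneg (g 0 0 - g 1 0)
      fin_cases i <;> fin_cases j <;> simp [X] at hij ⊢ <;> intros <;> nlinarith
    · intro i j hij
      rw [Function.onFun, Set.disjoint_left]
      intro g
      have := hne g
      have := mul_self_nonneg (g 0 0 + g 1 0)
      fin_cases i <;> fin_cases j <;> simp [Y] at hij ⊢ <;> intros <;> nlinarith
    · intro i j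
      rw [Set.disjoint_left]
      intro g
      have := hne g
      have := mul_self_nonneg (g 0 0)
      have := mul_self_nonneg (g 1 0)
      fin_cases i <;> fin_cases j <;> simp [X, Y] <;> intros <;> nlinarith
    · intro i
      rintro _ ⟨g, hg, rfl⟩
      fin_cases i
      · replace hg : ¬ (2 * (g 0 0 * g 1 0) < - 3 * (g 1 0 * g 1 0)) := hg
        change 3 * ((A * g) 1 0 * (A * g) 1 0) ≤ 2 * ((A * g) 0 0 * (A * g) 1 0)
        rw [hA0, hA1]; nlinarith
      · replace hg : ¬ (2 * (g 0 0 * g 1 0) < - 3 * (g 0 0 * g 0 0)) := hg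
        change 3 * ((B * g) 0 0 * (B * g) 0 0) ≤ 2 * ((B * g) 0 0 * (B * g) 1 0)
        rw [hB0, hB1]; nlinarith
    · intro i
      rintro _ ⟨g, hg, rfl⟩
      fin_cases i
      · replace hg : ¬ (3 * (g 1 0 * g 1 0) ≤ 2 * (g 0 0 * g 1 0)) := hg
        change 2 * ((A⁻¹ * g) 0 0 * (A⁻¹ * g) 1 0) < - 3 * ((A⁻¹ * g) 1 0 * (A⁻¹ * g) 1 0)
        have e0 := hA0 (A⁻¹ * g)
        have e1 := hA1 (A⁻¹ * g)
        rw [mul_inv_cancel_left] at e0 e1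
        rw [e0, e1] at hg
        nlinarith
      · replace hg : ¬ (3 * (g 0 0 * g 0 0) ≤ 2 * (g 0 0 * g 1 0)) := hg
        change 2 * ((B⁻¹ * g) 0 0 * (B⁻¹ * g) 1 0) < - 3 * ((B⁻¹ * g) 0 0 * (B⁻¹ * g) 0 0)
        have e0 := hB0 (B⁻¹ * g)
        have e1 := hB1 (B⁻¹ * g)
        rw [mul_inv_cancel_left] at e0 e1
        rw [e0, e1] at hg
        nlinarith
  let M : SpecialLinearGroup (Fin 2) ℤ →* Matrix (Fin 2) (Fin 2) ℂ :=
    { toFun := fun g => (Int.castRingHom ℂ).mapMatrix g.1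
      map_one' := by simp
      map_mul' := by intro a b; exact map_mul (Int.castRingHom ℂ).mapMatrix a.1 b.1 }
  have hM : Function.Injective M := by
    intro a b hab
    ext i j
    have := congrFun (congrFun hab i) j
    simpa [M] using this
  exact ⟨M.comp (FreeGroup.lift ![A, B]), hM.comp hinj⟩

theorem minimal_faithful_rep_dimension_of_free_torus (n : ℕ) (hn : 1 ≤ n) :
    (∃ f : (Fin n → FreeGroup (Fin 2)) →* GL (Fin (2 * n)) ℂ, Function.Injective f) ∧
      ¬ ∃ f : (Fin n → FreeGroup (Fin 2)) →* GL (Fin (2 * n - 1)) ℂ, Function.Injective f := by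
  constructor
  · obtain ⟨f, hf⟩ := free_embed
    let F : (Fin n → FreeGroup (Fin 2)) →* Matrix (Fin (2 * n)) (Fin (2 * n)) ℂ :=
      ((Matrix.reindexRingEquiv ℂ (finProdFinEquiv (m := 2) (n := n))).toRingHom.comp
        (Matrix.blockDiagonalRingHom (Fin 2) (Fin n) ℂ)).toMonoidHom.comp
        (MonoidHom.pi fun i => f.comp (Pi.evalMonoidHom _ i))
    have hF : Function.Injective F := by
      refine (Matrix.reindexRingEquiv ℂ (finProdFinEquiv (m := 2) (n := n))).injective.comp
        (Matrix.blockDiagonal_injective.comp ?_)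
      intro x y hxy
      funext i
      exact hf (congrFun hxy i)
    refine ⟨F.toHomUnits, fun x y hxy => hF ?_⟩
    exact congrArg Units.val hxy
  · rintro ⟨f, hf⟩
    let T : GL (Fin (2 * n - 1)) ℂ →* ((Fin (2 * n - 1) → ℂ) →ₗ[ℂ] (Fin (2 * n - 1) → ℂ)) :=
      (Units.coeHom _).comp Matrix.GeneralLinearGroup.toLin.toMonoidHom
    have hT : Function.Injective T :=
      Units.val_injective.comp Matrix.GeneralLinearGroup.toLin.injective
    let ρ : Fin n → Representation ℂ (FreeGroup (Fin 2)) (Fin (2 * n - 1) → ℂ) := fun i =>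
      (T.comp f).comp (MonoidHom.mulSingle (fun _ => FreeGroup (Fin 2)) i)
    have hρ : ∀ i, Function.Injective (ρ i) := fun i =>
      (hT.comp hf).comp (Pi.mulSingle_injective (M := fun _ => FreeGroup (Fin 2)) i)
    have := key_bound (2 * n - 1) (Fin (2 * n - 1) → ℂ) (Fin n) ρ (by simp)
      (by
        intro i j hij g h x
        have h1 : Commute (ρ i g) (ρ j h) :=
          (Pi.mulSingle_commute (f := fun _ => FreeGroup (Fin 2)) hij g h).map (T.comp f)
        exact LinearMap.congr_fun h1 x)
      (by
        rintro i ⟨m, hm⟩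
        refine free_not_solv ⟨m, ?_⟩
        rw [eq_bot_iff]
        intro k hk
        rw [Subgroup.mem_bot]
        apply hρ i
        rw [map_one]
        exact LinearMap.ext (hm k hk))
    simp at this
    omega
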